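/- arXiv:2210.09257 — 7 statements merged into one kernel-verified Lean document; each statement's English description precedes it below -/
import Mathlib

section
/- (Theorem 2, ε̂-MWMRE CCE duality.) Assume the Slater condition: there exist a joint distribution σ₀ and reals ε₀_p < ε⁺_p such that Σ_{a∈𝒜} σ₀(a) A^CCE_p(a'_p, a) < ε₀_p for every player p and all a'_p. Then the supremum of the primal objective F(σ, ε) over all pairs (σ, ε) such that σ is an ε-CCE and ε_p < ε⁺_p for all p equals the infimum of the dual loss L^CCE(α) over all nonnegative dual variables α. Moreover, if α* attains this infimum, then the primal supremum is attained at σ = σ_{α*} and ε_p = ε_p(α*). -/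
open scoped BigOperators

namespace NES

variable {N : ℕ} {A : Fin N → Type*}

/-- CCE deviation gain: `G_p(a'_p, a_{-p}) − G_p(a)`. -/
noncomputable def ACCE (G : ∀ _ : Fin N, (∀ q, A q) → ℝ) (p : Fin N) (a' : A p)
    (a : ∀ q, A q) : ℝ :=
  G p (Function.update a p a') - G p a

variable [∀ q, Fintype (A q)]

/-- σ is a joint distribution. -/
def IsJointDist (σ : (∀ q, A q) → ℝ) : Prop :=
  (∀ a, 0 ≤ σ a) ∧ ∑ a, σ a = 1

/-- σ is an ε-CCE (constraint part). -/
def IsEpsCCE (G : ∀ _ : Fin N, (∀ q, A q) → ℝ) (ε : Fin N → ℝ)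
    (σ : (∀ q, A q) → ℝ) : Prop :=
  ∀ (p : Fin N) (a' : A p), ∑ a, σ a * ACCE G p a' a ≤ ε p

/-- `S_p(α) = Σ_{a'_p} α_p(a'_p)`. -/
noncomputable def Ssum (α : ∀ p : Fin N, A p → ℝ) (p : Fin N) : ℝ :=
  ∑ a' : A p, α p a'

/-- Logits `l_α(a) = μ W(a) − Σ_{p,a'_p} α_p(a'_p) A^CCE_p(a'_p, a)`. -/
noncomputable def logitsCCE (G : ∀ _ : Fin N, (∀ q, A q) → ℝ) (μ : ℝ)
    (W : (∀ q, A q) → ℝ) (α : ∀ p : Fin N, A p → ℝ) (a : ∀ q, A q) : ℝ :=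
  μ * W a - ∑ p, ∑ a' : A p, α p a' * ACCE G p a' a

/-- Dual loss
`L^CCE(α) = ln Σ_a σ̂(a) e^{l_α(a)} + Σ_p ε⁺_p S_p(α) − ρ Σ_p (ε̂_p − ε⁺_p) e^{−S_p(α)/ρ}`. -/
noncomputable def lossCCE (G : ∀ _ : Fin N, (∀ q, A q) → ℝ)
    (σhat W : (∀ q, A q) → ℝ) (μ ρ : ℝ) (εhat εplus : Fin N → ℝ)
    (α : ∀ p : Fin N, A p → ℝ) : ℝ :=
  Real.log (∑ a, σhat a * Real.exp (logitsCCE G μ W α a))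
    + ∑ p, εplus p * Ssum α p
    - ρ * ∑ p, (εhat p - εplus p) * Real.exp (-Ssum α p / ρ)

/-- Primal joint `σ_α(a) = σ̂(a) e^{l_α(a)} / Σ_b σ̂(b) e^{l_α(b)}`. -/
noncomputable def sigmaDualCCE (G : ∀ _ : Fin N, (∀ q, A q) → ℝ)
    (σhat W : (∀ q, A q) → ℝ) (μ : ℝ)
    (α : ∀ p : Fin N, A p → ℝ) (a : ∀ q, A q) : ℝ :=
  σhat a * Real.exp (logitsCCE G μ W α a)
    / ∑ b, σhat b * Real.exp (logitsCCE G μ W α b)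

/-- Primal approximation `ε_p(α) = (ε̂_p − ε⁺_p) e^{−S_p(α)/ρ} + ε⁺_p`. -/
noncomputable def epsDualCCE (ρ : ℝ) (εhat εplus : Fin N → ℝ)
    (α : ∀ p : Fin N, A p → ℝ) (p : Fin N) : ℝ :=
  (εhat p - εplus p) * Real.exp (-Ssum α p / ρ) + εplus p

/-- Primal objective
`F(σ,ε) = μ Σ σ W − Σ σ ln(σ/σ̂) − ρ Σ_p (ε⁺_p − ε_p) ln((ε⁺_p − ε_p)/(e (ε⁺_p − ε̂_p)))`
(the convention `0 · ln 0 = 0` holds automatically since `Real.log 0 = 0`). -/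
noncomputable def primalF (μ : ℝ) (W σhat : (∀ q, A q) → ℝ) (ρ : ℝ)
    (εhat εplus : Fin N → ℝ) (σ : (∀ q, A q) → ℝ) (ε : Fin N → ℝ) : ℝ :=
  μ * ∑ a, σ a * W a - (∑ a, σ a * Real.log (σ a / σhat a))
    - ρ * ∑ p, (εplus p - ε p) *
        Real.log ((εplus p - ε p) / (Real.exp 1 * (εplus p - εhat p)))

lemma gibbs_le {ι : Type*} [Fintype ι] [Nonempty ι] (s h l : ι → ℝ) (hs : ∀ a, 0 ≤ s a)
    (h1 : ∑ a, s a = 1) (hh : ∀ a, 0 < h a) :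
    ∑ a, s a * l a - ∑ a, s a * Real.log (s a / h a)
      ≤ Real.log (∑ a, h a * Real.exp (l a)) := by
  have hZ : 0 < ∑ a, h a * Real.exp (l a) :=
    Finset.sum_pos (fun a _ => mul_pos (hh a) (Real.exp_pos _)) Finset.univ_nonempty
  set Z := ∑ a, h a * Real.exp (l a) with hZdef
  have key : ∀ a, s a * l a - s a * Real.log (s a / h a) - s a * Real.log Z
      ≤ h a * Real.exp (l a) / Z - s a := by
    intro a
    have he := Real.exp_pos (l a)
    rcases (hs a).eq_or_lt with h0 | h0
    · rw [← h0]
      have := div_nonneg (mul_nonneg (hh a).le he.le) hZ.le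
      simpa using this
    · have hx : 0 < h a * Real.exp (l a) / (s a * Z) := by
        have := hh a
        positivity
      have hl := Real.log_le_sub_one_of_pos hx
      rw [Real.log_div (mul_pos (hh a) he).ne' (mul_pos h0 hZ).ne',
        Real.log_mul (hh a).ne' he.ne', Real.log_mul h0.ne' hZ.ne', Real.log_exp] at hl
      rw [Real.log_div h0.ne' (hh a).ne']
      have h2 := mul_le_mul_of_nonneg_left hl h0.le
      have h3 : s a * (h a * Real.exp (l a) / (s a * Z) - 1)
          = h a * Real.exp (l a) / Z - s a := by
        field_simp
      linarith
  have hsum := Finset.sum_le_sum (fun a (_ : a ∈ Finset.univ) => key a)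
  simp only [Finset.sum_sub_distrib, ← Finset.sum_mul, ← Finset.sum_div] at hsum
  rw [← hZdef, div_self hZ.ne', h1] at hsum
  linarith

lemma swap_sum (G : ∀ _ : Fin N, (∀ q, A q) → ℝ) (σ : (∀ q, A q) → ℝ)
    (α : ∀ p : Fin N, A p → ℝ) :
    ∑ a, σ a * ∑ p, ∑ a' : A p, α p a' * ACCE G p a' a
      = ∑ p, ∑ a' : A p, α p a' * ∑ a, σ a * ACCE G p a' a := by
  simp only [Finset.mul_sum]
  rw [Finset.sum_comm]
  refine Finset.sum_congr rfl fun p _ => ?_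
  rw [Finset.sum_comm]
  refine Finset.sum_congr rfl fun a' _ => Finset.sum_congr rfl fun a _ => ?_
  ring

lemma sum_logits (G : ∀ _ : Fin N, (∀ q, A q) → ℝ) (σ : (∀ q, A q) → ℝ) (μ : ℝ)
    (W : (∀ q, A q) → ℝ) (α : ∀ p : Fin N, A p → ℝ) :
    ∑ a, σ a * logitsCCE G μ W α a = μ * ∑ a, σ a * W a
      - ∑ p, ∑ a' : A p, α p a' * ∑ a, σ a * ACCE G p a' a := by
  rw [← swap_sum, Finset.mul_sum, ← Finset.sum_sub_distrib]
  refine Finset.sum_congr rfl fun a _ => ?_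
  unfold logitsCCE
  ring

lemma sum_const (c : Fin N → ℝ) (α : ∀ p : Fin N, A p → ℝ) :
    ∑ p, c p * Ssum α p = ∑ p, ∑ a' : A p, α p a' * c p := by
  refine Finset.sum_congr rfl fun p _ => ?_
  rw [Ssum, Finset.mul_sum]
  exact Finset.sum_congr rfl fun _ _ => mul_comm _ _

lemma loss_lower [∀ q, Nonempty (A q)]
    (G : ∀ _ : Fin N, (∀ q, A q) → ℝ)
    (σhat : (∀ q, A q) → ℝ) (hpos : ∀ a, 0 < σhat a)
    (W : (∀ q, A q) → ℝ) (μ ρ : ℝ)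
    (εhat εplus : Fin N → ℝ) (σ : (∀ q, A q) → ℝ) (hσ : IsJointDist σ)
    (α : ∀ p : Fin N, A p → ℝ) :
    μ * ∑ a, σ a * W a - (∑ a, σ a * Real.log (σ a / σhat a))
      + ∑ p, ∑ a' : A p, α p a' * (εplus p - ∑ a, σ a * ACCE G p a' a)
      + ρ * ∑ p, (εplus p - εhat p) * Real.exp (-Ssum α p / ρ)
      ≤ lossCCE G σhat W μ ρ εhat εplus α := by
  have h := gibbs_le σ σhat (logitsCCE G μ W α) hσ.1 hσ.2 hpos
  rw [sum_logits] at h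
  unfold lossCCE
  rw [sum_const]
  have e1 : ∑ p, (εhat p - εplus p) * Real.exp (-Ssum α p / ρ)
      = - ∑ p, (εplus p - εhat p) * Real.exp (-Ssum α p / ρ) := by
    rw [← Finset.sum_neg_distrib]
    exact Finset.sum_congr rfl fun _ _ => by ring
  rw [e1]
  simp only [mul_sub, Finset.sum_sub_distrib] at h ⊢
  linarith

lemma eps_ineq (ρ u d S : ℝ) (hρ : 0 < ρ) (hu : 0 < u) (hd : 0 < d) :
    - (ρ * (u * Real.log (u / (Real.exp 1 * d)))) ≤ u * S + ρ * (d * Real.exp (-S / ρ)) := by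
  have he := Real.exp_pos (-S / ρ)
  have h1 := Real.exp_pos 1
  have hl := Real.log_le_sub_one_of_pos (x := d * Real.exp (-S / ρ) / u) (by positivity)
  rw [Real.log_div (by positivity) hu.ne', Real.log_mul hd.ne' he.ne', Real.log_exp] at hl
  rw [Real.log_div hu.ne' (by positivity), Real.log_mul h1.ne' hd.ne', Real.log_exp]
  have h2 := mul_le_mul_of_nonneg_left hl (mul_pos hρ hu).le
  have h3 : ρ * u * (d * Real.exp (-S / ρ) / u - 1) = ρ * (d * Real.exp (-S / ρ)) - ρ * u := by
    field_simp
  have h4 : ρ * u * (Real.log d + -S / ρ - Real.log u)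
      = ρ * u * (Real.log d - Real.log u) - u * S := by
    field_simp
    ring
  rw [h3, h4] at h2
  nlinarith

lemma weak_duality [∀ q, Nonempty (A q)]
    (G : ∀ _ : Fin N, (∀ q, A q) → ℝ)
    (σhat : (∀ q, A q) → ℝ) (hpos : ∀ a, 0 < σhat a)
    (W : (∀ q, A q) → ℝ) (μ ρ : ℝ) (hρ : 0 < ρ)
    (εhat εplus : Fin N → ℝ) (htgt : ∀ p, εhat p < εplus p)
    (σ : (∀ q, A q) → ℝ) (ε : Fin N → ℝ) (hσ : IsJointDist σ)
    (hε : ∀ p, ε p < εplus p) (hc : IsEpsCCE G ε σ)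
    (α : ∀ p : Fin N, A p → ℝ) (hα : ∀ p a', 0 ≤ α p a') :
    primalF μ W σhat ρ εhat εplus σ ε ≤ lossCCE G σhat W μ ρ εhat εplus α := by
  refine le_trans ?_ (loss_lower G σhat hpos W μ ρ εhat εplus σ hσ α)
  have h1 : ∑ p, (εplus p - ε p) * Ssum α p
      ≤ ∑ p, ∑ a' : A p, α p a' * (εplus p - ∑ a, σ a * ACCE G p a' a) := by
    rw [sum_const (fun p => εplus p - ε p)]
    refine Finset.sum_le_sum fun p _ => Finset.sum_le_sum fun a' _ => ?_
    exact mul_le_mul_of_nonneg_left (by linarith [hc p a']) (hα p a')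
  have h2 := Finset.sum_le_sum (fun p (_ : p ∈ Finset.univ) =>
    eps_ineq ρ (εplus p - ε p) (εplus p - εhat p) (Ssum α p) hρ
      (by linarith [hε p]) (by linarith [htgt p]))
  rw [Finset.sum_neg_distrib, Finset.sum_add_distrib, ← Finset.mul_sum, ← Finset.mul_sum] at h2
  unfold primalF
  linarith

lemma Z_pos [∀ q, Nonempty (A q)] (σhat : (∀ q, A q) → ℝ) (hpos : ∀ a, 0 < σhat a)
    (l : (∀ q, A q) → ℝ) : 0 < ∑ a, σhat a * Real.exp (l a) :=
  Finset.sum_pos (fun a _ => mul_pos (hpos a) (Real.exp_pos _)) Finset.univ_nonempty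

lemma sigma_dist [∀ q, Nonempty (A q)]
    (G : ∀ _ : Fin N, (∀ q, A q) → ℝ)
    (σhat : (∀ q, A q) → ℝ) (hpos : ∀ a, 0 < σhat a)
    (W : (∀ q, A q) → ℝ) (μ : ℝ) (α : ∀ p : Fin N, A p → ℝ) :
    IsJointDist (sigmaDualCCE G σhat W μ α) := by
  have hZ := Z_pos σhat hpos (logitsCCE G μ W α)
  constructor
  · intro a
    exact div_nonneg (mul_nonneg (hpos a).le (Real.exp_pos _).le) hZ.le
  · unfold sigmaDualCCE
    rw [← Finset.sum_div, div_self hZ.ne']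

lemma eps_lt (ρ : ℝ) (εhat εplus : Fin N → ℝ) (htgt : ∀ p, εhat p < εplus p)
    (α : ∀ p : Fin N, A p → ℝ) (p : Fin N) : epsDualCCE ρ εhat εplus α p < εplus p := by
  unfold epsDualCCE
  have := mul_pos (sub_pos.2 (htgt p)) (Real.exp_pos (-Ssum α p / ρ))
  linarith

lemma primal_eq [∀ q, Nonempty (A q)]
    (G : ∀ _ : Fin N, (∀ q, A q) → ℝ)
    (σhat : (∀ q, A q) → ℝ) (hpos : ∀ a, 0 < σhat a)
    (W : (∀ q, A q) → ℝ) (μ ρ : ℝ) (hρ : 0 < ρ)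
    (εhat εplus : Fin N → ℝ) (htgt : ∀ p, εhat p < εplus p)
    (α : ∀ p : Fin N, A p → ℝ) :
    primalF μ W σhat ρ εhat εplus (sigmaDualCCE G σhat W μ α) (epsDualCCE ρ εhat εplus α)
      = lossCCE G σhat W μ ρ εhat εplus α
        - ∑ p, ∑ a' : A p, α p a' * (epsDualCCE ρ εhat εplus α p
            - ∑ a, sigmaDualCCE G σhat W μ α a * ACCE G p a' a) := by
  have hZ := Z_pos σhat hpos (logitsCCE G μ W α)
  have hd := sigma_dist G σhat hpos W μ α
  have h1 : ∑ a, sigmaDualCCE G σhat W μ α a * Real.log (sigmaDualCCE G σhat W μ α a / σhat a)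
      = ∑ a, sigmaDualCCE G σhat W μ α a * logitsCCE G μ W α a
        - Real.log (∑ a, σhat a * Real.exp (logitsCCE G μ W α a)) := by
    have : ∀ a, Real.log (sigmaDualCCE G σhat W μ α a / σhat a)
        = logitsCCE G μ W α a - Real.log (∑ a, σhat a * Real.exp (logitsCCE G μ W α a)) := by
      intro a
      have e : sigmaDualCCE G σhat W μ α a / σhat a = Real.exp (logitsCCE G μ W α a)
          / (∑ a, σhat a * Real.exp (logitsCCE G μ W α a)) := by
        have := (hpos a).ne'
        unfold sigmaDualCCE
        field_simp
      rw [e, Real.log_div (Real.exp_pos _).ne' hZ.ne', Real.log_exp]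
    simp only [this, mul_sub, Finset.sum_sub_distrib, ← Finset.sum_mul]
    rw [hd.2, one_mul]
  have h2 : ρ * ∑ p, (εplus p - epsDualCCE ρ εhat εplus α p) *
        Real.log ((εplus p - epsDualCCE ρ εhat εplus α p) / (Real.exp 1 * (εplus p - εhat p)))
      = ∑ p, epsDualCCE ρ εhat εplus α p * Ssum α p - ∑ p, εplus p * Ssum α p
        + ρ * ∑ p, (εhat p - εplus p) * Real.exp (-Ssum α p / ρ) := by
    rw [Finset.mul_sum, Finset.mul_sum, ← Finset.sum_sub_distrib, ← Finset.sum_add_distrib]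
    refine Finset.sum_congr rfl fun p _ => ?_
    have hdp : 0 < εplus p - εhat p := sub_pos.2 (htgt p)
    have e : (εplus p - epsDualCCE ρ εhat εplus α p) / (Real.exp 1 * (εplus p - εhat p))
        = Real.exp (-Ssum α p / ρ - 1) := by
      rw [Real.exp_sub]
      unfold epsDualCCE
      field_simp
      ring
    rw [e, Real.log_exp]
    unfold epsDualCCE
    field_simp
    ring
  unfold primalF
  rw [h1, h2, sum_logits, sum_const (epsDualCCE ρ εhat εplus α)]
  unfold lossCCE
  simp only [mul_sub, Finset.sum_sub_distrib]
  ring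

lemma loss_deriv [∀ q, Nonempty (A q)]
    (G : ∀ _ : Fin N, (∀ q, A q) → ℝ)
    (σhat : (∀ q, A q) → ℝ) (hpos : ∀ a, 0 < σhat a)
    (W : (∀ q, A q) → ℝ) (μ ρ : ℝ) (hρ : 0 < ρ)
    (εhat εplus : Fin N → ℝ) (α β : ∀ p : Fin N, A p → ℝ) :
    HasDerivAt (fun t : ℝ => lossCCE G σhat W μ ρ εhat εplus (fun p a' => α p a' + t * β p a'))
      (∑ p, ∑ a' : A p, β p a' * (epsDualCCE ρ εhat εplus α p
            - ∑ a, sigmaDualCCE G σhat W μ α a * ACCE G p a' a)) 0 := by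
  have hZ := Z_pos σhat hpos (logitsCCE G μ W α)
  have hl : ∀ (t : ℝ) a, logitsCCE G μ W (fun p a' => α p a' + t * β p a') a
      = logitsCCE G μ W α a + t * (- ∑ p, ∑ a' : A p, β p a' * ACCE G p a' a) := by
    intro t a
    unfold logitsCCE
    simp only [add_mul, Finset.sum_add_distrib, mul_assoc, ← Finset.mul_sum]
    ring
  have hS : ∀ (t : ℝ) p, Ssum (fun p a' => α p a' + t * β p a') p
      = Ssum α p + t * Ssum β p := by
    intro t p
    unfold Ssum
    rw [Finset.sum_add_distrib, Finset.mul_sum]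
  unfold lossCCE
  simp only [hl, hS]
  have lin : ∀ x y : ℝ, HasDerivAt (fun t : ℝ => x + t * y) y 0 := by
    intro x y
    simpa using ((hasDerivAt_id (0:ℝ)).mul_const y).const_add x
  have d1 := HasDerivAt.fun_sum (u := Finset.univ) (fun a _ =>
    ((lin (logitsCCE G μ W α a) (- ∑ p, ∑ a' : A p, β p a' * ACCE G p a' a)).exp).const_mul (σhat a))
  have d1' := d1.log (by simpa using hZ.ne')
  have d2 := HasDerivAt.fun_sum (u := Finset.univ) (fun p _ =>
    (lin (Ssum α p) (Ssum β p)).const_mul (εplus p))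
  have d3 := HasDerivAt.fun_sum (u := Finset.univ) (fun p _ =>
    ((((lin (Ssum α p) (Ssum β p)).neg).div_const ρ).exp).const_mul (εhat p - εplus p))
  have d := (d1'.add d2).sub (d3.const_mul ρ)
  refine HasDerivAt.congr_deriv (f := _) d ?_
  simp only [zero_mul, add_zero, Pi.neg_apply]
  have e1 : (∑ a, σhat a * (Real.exp (logitsCCE G μ W α a)
        * (- ∑ p, ∑ a' : A p, β p a' * ACCE G p a' a)))
        / (∑ a, σhat a * Real.exp (logitsCCE G μ W α a))
      = - ∑ p, ∑ a' : A p, β p a' * ∑ a, sigmaDualCCE G σhat W μ α a * ACCE G p a' a := by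
    rw [← swap_sum, Finset.sum_div, ← Finset.sum_neg_distrib]
    refine Finset.sum_congr rfl fun a _ => ?_
    unfold sigmaDualCCE
    ring
  rw [e1]
  have e2 : ∑ p, ∑ a' : A p, β p a' * epsDualCCE ρ εhat εplus α p
      = ∑ p, εplus p * Ssum β p - ρ * ∑ p, (εhat p - εplus p) *
        (Real.exp (-Ssum α p / ρ) * (-Ssum β p / ρ)) := by
    rw [← sum_const, Finset.mul_sum, ← Finset.sum_sub_distrib]
    refine Finset.sum_congr rfl fun p _ => ?_
    unfold epsDualCCE
    field_simp
    ring
  simp only [mul_sub, Finset.sum_sub_distrib]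
  rw [e2]
  ring

lemma deriv_nonneg_of_min (f : ℝ → ℝ) (d : ℝ) (hf : HasDerivAt f d 0)
    (hm : ∀ t, 0 < t → t < 1 → f 0 ≤ f t) : 0 ≤ d := by
  have h := (hasDerivWithinAt_iff_tendsto_slope' (s := Set.Ioi 0) (by simp)).1
    hf.hasDerivWithinAt
  refine ge_of_tendsto h ?_
  filter_upwards [Ioo_mem_nhdsGT (zero_lt_one' ℝ)] with t ht
  rw [slope_def_field]
  exact div_nonneg (by linarith [hm t ht.1 ht.2]) (by linarith [ht.1])

lemma kkt [∀ q, Nonempty (A q)]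
    (G : ∀ _ : Fin N, (∀ q, A q) → ℝ)
    (σhat : (∀ q, A q) → ℝ) (hpos : ∀ a, 0 < σhat a)
    (W : (∀ q, A q) → ℝ) (μ ρ : ℝ) (hρ : 0 < ρ)
    (εhat εplus : Fin N → ℝ) (htgt : ∀ p, εhat p < εplus p)
    (αstar : ∀ p : Fin N, A p → ℝ) (hα : ∀ p a', 0 ≤ αstar p a')
    (hmin : ∀ α : ∀ p : Fin N, A p → ℝ, (∀ p a', 0 ≤ α p a') →
        lossCCE G σhat W μ ρ εhat εplus αstar ≤ lossCCE G σhat W μ ρ εhat εplus α) :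
    IsEpsCCE G (epsDualCCE ρ εhat εplus αstar) (sigmaDualCCE G σhat W μ αstar) ∧
    primalF μ W σhat ρ εhat εplus (sigmaDualCCE G σhat W μ αstar)
          (epsDualCCE ρ εhat εplus αstar) = lossCCE G σhat W μ ρ εhat εplus αstar := by
  classical
  have dir : ∀ β : ∀ p : Fin N, A p → ℝ,
      (∀ t : ℝ, 0 < t → t < 1 → ∀ p a', 0 ≤ αstar p a' + t * β p a') →
      0 ≤ ∑ p, ∑ a' : A p, β p a' * (epsDualCCE ρ εhat εplus αstar p
            - ∑ a, sigmaDualCCE G σhat W μ αstar a * ACCE G p a' a) := by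
    intro β hβ
    refine deriv_nonneg_of_min _ _ (loss_deriv G σhat hpos W μ ρ hρ εhat εplus αstar β) ?_
    intro t h0 h1
    simpa using hmin _ (hβ t h0 h1)
  have hfeas : IsEpsCCE G (epsDualCCE ρ εhat εplus αstar) (sigmaDualCCE G σhat W μ αstar) := by
    intro p a'
    have h := dir (Pi.single p (Pi.single a' 1)) (by
      intro t h0 _ q b
      have h1 : (0 : ∀ p : Fin N, A p → ℝ) ≤ Pi.single p (Pi.single a' 1) := by
        rw [Pi.single_nonneg, Pi.single_nonneg]
        exact zero_le_one
      exact add_nonneg (hα q b) (mul_nonneg h0.le (h1 q b)))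
    rw [Finset.sum_eq_single p, Finset.sum_eq_single a'] at h
    · simp only [Pi.single_eq_same] at h
      linarith
    · intro b _ hb
      simp [Pi.single_eq_of_ne hb]
    · simp
    · intro q _ hq
      simp [Pi.single_eq_of_ne hq]
    · simp
  refine ⟨hfeas, le_antisymm ?_ ?_⟩
  · exact weak_duality G σhat hpos W μ ρ hρ εhat εplus htgt _ _
      (sigma_dist G σhat hpos W μ αstar) (eps_lt ρ εhat εplus htgt αstar) hfeas αstar hα
  · rw [primal_eq G σhat hpos W μ ρ hρ εhat εplus htgt αstar]
    have h := dir (fun p a' => - αstar p a') (by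
      intro t h0 h1 q b
      nlinarith [hα q b])
    simp only [neg_mul, Finset.sum_neg_distrib] at h
    linarith

lemma loss_continuous [∀ q, Nonempty (A q)]
    (G : ∀ _ : Fin N, (∀ q, A q) → ℝ)
    (σhat : (∀ q, A q) → ℝ) (hpos : ∀ a, 0 < σhat a)
    (W : (∀ q, A q) → ℝ) (μ ρ : ℝ) (εhat εplus : Fin N → ℝ) :
    Continuous (lossCCE G σhat W μ ρ εhat εplus) := by
  have hl : ∀ a, Continuous (fun α => logitsCCE G μ W α a) := by
    intro a
    unfold logitsCCE
    fun_prop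
  have hS : ∀ p, Continuous (fun α : ∀ p : Fin N, A p → ℝ => Ssum α p) := by
    intro p
    unfold Ssum
    fun_prop
  unfold lossCCE
  refine Continuous.sub (Continuous.add (Continuous.log ?_ ?_) ?_) ?_
  · exact continuous_finsetSum _ fun a _ => continuous_const.mul (Real.continuous_exp.comp (hl a))
  · intro α
    exact (Z_pos σhat hpos (logitsCCE G μ W α)).ne'
  · exact continuous_finsetSum _ fun p _ => continuous_const.mul (hS p)
  · exact continuous_const.mul (continuous_finsetSum _ fun p _ => continuous_const.mul
      (Real.continuous_exp.comp ((hS p).neg.div_const ρ)))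

lemma exists_min [∀ q, Nonempty (A q)]
    (G : ∀ _ : Fin N, (∀ q, A q) → ℝ)
    (σhat : (∀ q, A q) → ℝ) (hpos : ∀ a, 0 < σhat a)
    (W : (∀ q, A q) → ℝ) (μ ρ : ℝ) (hρ : 0 < ρ)
    (εhat εplus : Fin N → ℝ) (htgt : ∀ p, εhat p < εplus p)
    (σ₀ : (∀ q, A q) → ℝ) (ε₀ : Fin N → ℝ)
    (hσ₀ : IsJointDist σ₀) (hε₀ : ∀ p, ε₀ p < εplus p)
    (hslater : ∀ (p : Fin N) (a' : A p), ∑ a, σ₀ a * ACCE G p a' a < ε₀ p) :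
    ∃ αstar : ∀ p : Fin N, A p → ℝ, (∀ p a', 0 ≤ αstar p a') ∧
      ∀ α : ∀ p : Fin N, A p → ℝ, (∀ p a', 0 ≤ α p a') →
        lossCCE G σhat W μ ρ εhat εplus αstar ≤ lossCCE G σhat W μ ρ εhat εplus α := by
  set c := μ * ∑ a, σ₀ a * W a - (∑ a, σ₀ a * Real.log (σ₀ a / σhat a)) with hc
  set L0 := lossCCE G σhat W μ ρ εhat εplus 0 with hL0
  have hcoer : ∀ α : ∀ p : Fin N, A p → ℝ, (∀ p a', 0 ≤ α p a') → ∀ p a',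
      c + α p a' * (εplus p - ε₀ p) ≤ lossCCE G σhat W μ ρ εhat εplus α := by
    intro α hα p a'
    have h := loss_lower G σhat hpos W μ ρ εhat εplus σ₀ hσ₀ α
    have h1 : 0 ≤ ρ * ∑ p, (εplus p - εhat p) * Real.exp (-Ssum α p / ρ) :=
      mul_nonneg hρ.le (Finset.sum_nonneg fun p _ =>
        mul_nonneg (sub_pos.2 (htgt p)).le (Real.exp_pos _).le)
    have hterm : ∀ q (b : A q), α q b * (εplus q - ε₀ q)
        ≤ α q b * (εplus q - ∑ a, σ₀ a * ACCE G q b a) := fun q b =>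
      mul_le_mul_of_nonneg_left (by linarith [hslater q b]) (hα q b)
    have hnn : ∀ q (b : A q), 0 ≤ α q b * (εplus q - ∑ a, σ₀ a * ACCE G q b a) := fun q b =>
      (mul_nonneg (hα q b) (sub_pos.2 (hε₀ q)).le).trans (hterm q b)
    have h2 : α p a' * (εplus p - ∑ a, σ₀ a * ACCE G p a' a)
        ≤ ∑ b : A p, α p b * (εplus p - ∑ a, σ₀ a * ACCE G p b a) :=
      Finset.single_le_sum (f := fun b : A p => α p b * (εplus p - ∑ a, σ₀ a * ACCE G p b a))
        (fun b _ => hnn p b) (Finset.mem_univ a')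
    have h3 : ∑ b : A p, α p b * (εplus p - ∑ a, σ₀ a * ACCE G p b a)
        ≤ ∑ q, ∑ b : A q, α q b * (εplus q - ∑ a, σ₀ a * ACCE G q b a) :=
      Finset.single_le_sum
        (f := fun q => ∑ b : A q, α q b * (εplus q - ∑ a, σ₀ a * ACCE G q b a))
        (fun q _ => Finset.sum_nonneg fun b _ => hnn q b) (Finset.mem_univ p)
    linarith [hterm p a']
  set R : ℝ := ∑ p, |L0 - c| / (εplus p - ε₀ p) with hR
  have hRnn : ∀ p, 0 ≤ |L0 - c| / (εplus p - ε₀ p) := fun p =>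
    div_nonneg (abs_nonneg _) (sub_pos.2 (hε₀ p)).le
  have hR0 : 0 ≤ R := Finset.sum_nonneg fun p _ => hRnn p
  have hcomp : IsCompact (Set.Icc (0 : ∀ p : Fin N, A p → ℝ) (fun _ _ => R)) := isCompact_Icc
  obtain ⟨αs, hαs, hm⟩ := hcomp.exists_isMinOn ⟨0, le_refl _, fun _ _ => hR0⟩
    (loss_continuous G σhat hpos W μ ρ εhat εplus).continuousOn
  refine ⟨αs, fun p a' => hαs.1 p a', fun α hα => ?_⟩
  by_cases hin : ∀ p a', α p a' ≤ R
  · exact hm ⟨fun p a' => hα p a', fun p a' => hin p a'⟩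
  · push Not at hin
    obtain ⟨p, a', hpa⟩ := hin
    have h0 : lossCCE G σhat W μ ρ εhat εplus αs ≤ L0 := hm ⟨le_refl _, fun _ _ => hR0⟩
    have hd := sub_pos.2 (hε₀ p)
    have h1 : |L0 - c| / (εplus p - ε₀ p) ≤ R :=
      Finset.single_le_sum (f := fun p => |L0 - c| / (εplus p - ε₀ p))
        (fun q _ => hRnn q) (Finset.mem_univ p)
    have h2 := (div_le_iff₀ hd).1 (h1.trans hpa.le)
    linarith [hcoer α hα p a', le_abs_self (L0 - c)]

/-- Theorem 2 (ε̂-MWMRE CCE duality): under a Slater condition, the supremum of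
the primal objective over feasible (σ, ε) pairs equals the infimum of the dual
CCE loss over nonnegative dual variables, and any dual minimizer α* yields a
feasible primal maximizer (σ_{α*}, ε(α*)). -/
theorem mwmre_cce_duality [∀ q, Nonempty (A q)]
    (G : ∀ _ : Fin N, (∀ q, A q) → ℝ)
    (σhat : (∀ q, A q) → ℝ) (hpos : ∀ a, 0 < σhat a) (hsum : ∑ a, σhat a = 1)
    (W : (∀ q, A q) → ℝ) (μ ρ : ℝ) (hμ : 0 ≤ μ) (hρ : 0 < ρ)
    (εhat εplus : Fin N → ℝ) (htgt : ∀ p, εhat p < εplus p)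
    -- Slater condition
    (σ₀ : (∀ q, A q) → ℝ) (ε₀ : Fin N → ℝ)
    (hσ₀ : IsJointDist σ₀) (hε₀ : ∀ p, ε₀ p < εplus p)
    (hslater : ∀ (p : Fin N) (a' : A p), ∑ a, σ₀ a * ACCE G p a' a < ε₀ p) :
    sSup {v : ℝ | ∃ (σ : (∀ q, A q) → ℝ) (ε : Fin N → ℝ),
        IsJointDist σ ∧ (∀ p, ε p < εplus p) ∧ IsEpsCCE G ε σ ∧
        v = primalF μ W σhat ρ εhat εplus σ ε}
      = sInf {v : ℝ | ∃ α : ∀ p : Fin N, A p → ℝ, (∀ p a', 0 ≤ α p a') ∧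
        v = lossCCE G σhat W μ ρ εhat εplus α} ∧
    ∀ αstar : ∀ p : Fin N, A p → ℝ, (∀ p a', 0 ≤ αstar p a') →
      (∀ α : ∀ p : Fin N, A p → ℝ, (∀ p a', 0 ≤ α p a') →
        lossCCE G σhat W μ ρ εhat εplus αstar ≤ lossCCE G σhat W μ ρ εhat εplus α) →
      IsJointDist (sigmaDualCCE G σhat W μ αstar) ∧
      (∀ p, epsDualCCE ρ εhat εplus αstar p < εplus p) ∧
      IsEpsCCE G (epsDualCCE ρ εhat εplus αstar) (sigmaDualCCE G σhat W μ αstar) ∧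
      primalF μ W σhat ρ εhat εplus (sigmaDualCCE G σhat W μ αstar)
          (epsDualCCE ρ εhat εplus αstar)
        = sSup {v : ℝ | ∃ (σ : (∀ q, A q) → ℝ) (ε : Fin N → ℝ),
            IsJointDist σ ∧ (∀ p, ε p < εplus p) ∧ IsEpsCCE G ε σ ∧
            v = primalF μ W σhat ρ εhat εplus σ ε} := by
  have hgreat : ∀ αstar : ∀ p : Fin N, A p → ℝ, (∀ p a', 0 ≤ αstar p a') →
      (∀ α : ∀ p : Fin N, A p → ℝ, (∀ p a', 0 ≤ α p a') →
        lossCCE G σhat W μ ρ εhat εplus αstar ≤ lossCCE G σhat W μ ρ εhat εplus α) →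
      IsGreatest {v : ℝ | ∃ (σ : (∀ q, A q) → ℝ) (ε : Fin N → ℝ),
        IsJointDist σ ∧ (∀ p, ε p < εplus p) ∧ IsEpsCCE G ε σ ∧
        v = primalF μ W σhat ρ εhat εplus σ ε} (lossCCE G σhat W μ ρ εhat εplus αstar) := by
    intro αs hα hmin
    have hk := kkt G σhat hpos W μ ρ hρ εhat εplus htgt αs hα hmin
    refine ⟨⟨_, _, sigma_dist G σhat hpos W μ αs, eps_lt ρ εhat εplus htgt αs, hk.1,
      hk.2.symm⟩, ?_⟩
    rintro v ⟨σ, ε, h1, h2, h3, rfl⟩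
    exact weak_duality G σhat hpos W μ ρ hρ εhat εplus htgt σ ε h1 h2 h3 αs hα
  constructor
  · obtain ⟨αs, hα, hmin⟩ := exists_min G σhat hpos W μ ρ hρ εhat εplus htgt σ₀ ε₀ hσ₀ hε₀ hslater
    rw [(hgreat αs hα hmin).csSup_eq]
    symm
    apply IsLeast.csInf_eq
    refine ⟨⟨αs, hα, rfl⟩, ?_⟩
    rintro v ⟨α, h, rfl⟩
    exact hmin α h
  · intro αs hα hmin
    have hk := kkt G σhat hpos W μ ρ hρ εhat εplus htgt αs hα hmin
    exact ⟨sigma_dist G σhat hpos W μ αs, eps_lt ρ εhat εplus htgt αs, hk.1,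
      hk.2.trans (hgreat αs hα hmin).csSup_eq.symm⟩

end NES
end

section
/- (Weak duality for the CCE loss.) For every nonnegative dual variable α (α_p : 𝒜_p → ℝ_{≥0} for each player p), every joint distribution σ, and every ε ∈ ℝ^N with ε_p < ε⁺_p for all p such that σ is an ε-CCE, the dual loss dominates the primal objective: F(σ, ε) ≤ L^CCE(α). -/
open scoped BigOperators

namespace NES

variable {N : ℕ} {A : Fin N → Type*}

variable [∀ q, Fintype (A q)]

theorem mul_log_aux {x y : ℝ} (hx : 0 < x) (hy : 0 < y) :
    x * (Real.log y - Real.log x) ≤ y - x := by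
  have h := Real.log_le_sub_one_of_pos (div_pos hy hx)
  rw [Real.log_div hy.ne' hx.ne'] at h
  have h2 := mul_le_mul_of_nonneg_left h hx.le
  have h3 : x * (y / x - 1) = y - x := by field_simp
  linarith

theorem scalar_aux {x c S ρ : ℝ} (hx : 0 < x) (hc : 0 < c) (hρ : 0 < ρ) :
    -(ρ * (x * Real.log (x / (Real.exp 1 * c)))) ≤ S * x + ρ * (c * Real.exp (-S / ρ)) := by
  have h := mul_log_aux hx (mul_pos hc (Real.exp_pos (-S / ρ)))
  rw [Real.log_mul hc.ne' (Real.exp_pos _).ne', Real.log_exp] at h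
  rw [Real.log_div hx.ne' (mul_pos (Real.exp_pos _) hc).ne',
    Real.log_mul (Real.exp_pos _).ne' hc.ne', Real.log_exp]
  have h2 := mul_le_mul_of_nonneg_left h hρ.le
  have h3 : ρ * (x * (Real.log c + -S / ρ - Real.log x))
      = ρ * (x * (Real.log c - Real.log x)) - S * x := by field_simp; ring
  rw [h3] at h2
  linarith

theorem gibbs_aux {ι : Type*} [Fintype ι] [Nonempty ι] (s t l : ι → ℝ) (hs : ∀ a, 0 ≤ s a)
    (hs1 : ∑ a, s a = 1) (ht : ∀ a, 0 < t a) :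
    ∑ a, s a * l a - ∑ a, s a * Real.log (s a / t a)
      ≤ Real.log (∑ a, t a * Real.exp (l a)) := by
  set Z := ∑ a, t a * Real.exp (l a) with hZ
  have hZp : 0 < Z := Finset.sum_pos (fun a _ => mul_pos (ht a) (Real.exp_pos _))
    Finset.univ_nonempty
  have key : ∀ a, s a * l a - s a * Real.log (s a / t a) - s a * Real.log Z
      ≤ t a * Real.exp (l a) / Z - s a := by
    intro a
    have hp := mul_pos (ht a) (Real.exp_pos (l a))
    rcases (hs a).eq_or_lt with h0 | h0
    · rw [← h0]
      have := div_pos hp hZp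
      simpa using this.le
    · have h := mul_log_aux h0 (div_pos hp hZp)
      rw [Real.log_div hp.ne' hZp.ne', Real.log_mul (ht a).ne' (Real.exp_pos _).ne',
        Real.log_exp] at h
      rw [Real.log_div h0.ne' (ht a).ne']
      linarith
  have hsum := Finset.sum_le_sum (fun a (_ : a ∈ Finset.univ) => key a)
  rw [Finset.sum_sub_distrib, Finset.sum_sub_distrib, Finset.sum_sub_distrib,
    ← Finset.sum_mul, ← Finset.sum_div, ← hZ, hs1, div_self hZp.ne'] at hsum
  linarith

/-- Weak duality: the dual CCE loss dominates the primal objective on all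
feasible primal points. -/
theorem weak_duality_cce [∀ q, Nonempty (A q)]
    (G : ∀ _ : Fin N, (∀ q, A q) → ℝ)
    (σhat : (∀ q, A q) → ℝ) (hpos : ∀ a, 0 < σhat a) (hsum : ∑ a, σhat a = 1)
    (W : (∀ q, A q) → ℝ) (μ ρ : ℝ) (hμ : 0 ≤ μ) (hρ : 0 < ρ)
    (εhat εplus : Fin N → ℝ) (htgt : ∀ p, εhat p < εplus p)
    (α : ∀ p : Fin N, A p → ℝ) (hα : ∀ p a', 0 ≤ α p a')
    (σ : (∀ q, A q) → ℝ) (hσ : IsJointDist σ)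
    (ε : Fin N → ℝ) (hε : ∀ p, ε p < εplus p)
    (hCCE : IsEpsCCE G ε σ) :
    primalF μ W σhat ρ εhat εplus σ ε ≤ lossCCE G σhat W μ ρ εhat εplus α := by
  have h1 := gibbs_aux σ σhat (logitsCCE G μ W α) hσ.1 hσ.2 hpos
  have h2 : ∑ a, σ a * logitsCCE G μ W α a = μ * ∑ a, σ a * W a
      - ∑ p, ∑ a' : A p, α p a' * ∑ a, σ a * ACCE G p a' a := by
    simp only [logitsCCE, mul_sub, Finset.sum_sub_distrib, Finset.mul_sum]
    congr 1
    · exact Finset.sum_congr rfl fun a _ => by ring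
    · rw [Finset.sum_comm]
      refine Finset.sum_congr rfl fun p _ => ?_
      rw [Finset.sum_comm]
      exact Finset.sum_congr rfl fun a' _ => Finset.sum_congr rfl fun a _ => by ring
  have h3 : ∑ p, ∑ a' : A p, α p a' * ∑ a, σ a * ACCE G p a' a ≤ ∑ p, Ssum α p * ε p := by
    refine Finset.sum_le_sum fun p _ => ?_
    rw [Ssum, Finset.sum_mul]
    exact Finset.sum_le_sum fun a' _ => mul_le_mul_of_nonneg_left (hCCE p a') (hα p a')
  have h4 := Finset.sum_le_sum fun p (_ : p ∈ Finset.univ) =>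
    scalar_aux (S := Ssum α p) (sub_pos.2 (hε p)) (sub_pos.2 (htgt p)) hρ
  have h5 : ∑ p, (Ssum α p * (εplus p - ε p)
        + ρ * ((εplus p - εhat p) * Real.exp (-Ssum α p / ρ)))
      = ∑ p, εplus p * Ssum α p - ∑ p, Ssum α p * ε p
        - ρ * ∑ p, (εhat p - εplus p) * Real.exp (-Ssum α p / ρ) := by
    rw [Finset.mul_sum, ← Finset.sum_sub_distrib, ← Finset.sum_sub_distrib]
    exact Finset.sum_congr rfl fun p _ => by ring
  rw [h5, Finset.sum_neg_distrib, ← Finset.mul_sum] at h4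
  unfold primalF lossCCE
  linarith

end NES
end

section
/- (Gradient of the CCE loss.) Fix nonnegative dual variables α (α_p : 𝒜_p → ℝ_{≥0}), a player q, and a strategy b ∈ 𝒜_q. The function t ↦ L^CCE(α[α_q(b) := t]), obtained from L^CCE by varying only the coordinate α_q(b), is differentiable at t = α_q(b) with derivative ε_q(α) − Σ_{a∈𝒜} A^CCE_q(b, a) σ_α(a), where σ_α(a) = σ̂(a) exp(l_α(a)) / Σ_{c∈𝒜} σ̂(c) exp(l_α(c)) and ε_q(α) = (ε̂_q − ε⁺_q) exp(−S_q(α)/ρ) + ε⁺_q. -/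
open scoped BigOperators

namespace NES

variable {N : ℕ} {A : Fin N → Type*}

variable [∀ q, Fintype (A q)]

theorem upd_sum [∀ q, DecidableEq (A q)] (α : ∀ p : Fin N, A p → ℝ) (q : Fin N) (b : A q)
    (t : ℝ) (p : Fin N) (f : ∀ p : Fin N, A p → ℝ) :
    ∑ a' : A p, Function.update α q (Function.update (α q) b t) p a' * f p a'
      = ∑ a' : A p, α p a' * f p a' + if p = q then (t - α q b) * f q b else 0 := by
  by_cases h : p = q
  · subst h
    simp only [Function.update_self, if_true]
    rw [← sub_eq_iff_eq_add', ← Finset.sum_sub_distrib, Finset.sum_eq_single b]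
    · simp only [Function.update_self]; ring
    · intro c _ hc
      simp [Function.update_of_ne hc]
    · simp
  · simp [h]

theorem upd_Ssum [∀ q, DecidableEq (A q)] (α : ∀ p : Fin N, A p → ℝ) (q : Fin N) (b : A q)
    (t : ℝ) (p : Fin N) :
    Ssum (Function.update α q (Function.update (α q) b t)) p
      = Ssum α p + (if p = q then 1 else 0) * (t - α q b) := by
  have := upd_sum α q b t p (fun _ _ => 1)
  simp only [mul_one] at this
  unfold Ssum
  rw [this]
  split_ifs <;> simp

theorem upd_logits [∀ q, DecidableEq (A q)] (G : ∀ _ : Fin N, (∀ q, A q) → ℝ) (μ : ℝ)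
    (W : (∀ q, A q) → ℝ) (α : ∀ p : Fin N, A p → ℝ) (q : Fin N) (b : A q)
    (t : ℝ) (a : ∀ q, A q) :
    logitsCCE G μ W (Function.update α q (Function.update (α q) b t)) a
      = logitsCCE G μ W α a - (t - α q b) * ACCE G q b a := by
  unfold logitsCCE
  simp only [upd_sum α q b t _ (fun p a' => ACCE G p a' a), Finset.sum_add_distrib,
    Finset.sum_ite_eq', Finset.mem_univ, if_true]
  ring

/-- Gradient of the CCE loss: varying only the coordinate `α_q(b)`, the loss is
differentiable at the current value with derivative
`ε_q(α) − Σ_a A^CCE_q(b, a) σ_α(a)`. -/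
theorem gradient_lossCCE [∀ q, Nonempty (A q)] [∀ q, DecidableEq (A q)]
    (G : ∀ _ : Fin N, (∀ q, A q) → ℝ)
    (σhat : (∀ q, A q) → ℝ) (hpos : ∀ a, 0 < σhat a) (hsum : ∑ a, σhat a = 1)
    (W : (∀ q, A q) → ℝ) (μ ρ : ℝ) (hμ : 0 ≤ μ) (hρ : 0 < ρ)
    (εhat εplus : Fin N → ℝ) (htgt : ∀ p, εhat p < εplus p)
    (α : ∀ p : Fin N, A p → ℝ) (hα : ∀ p a', 0 ≤ α p a')
    (q : Fin N) (b : A q) :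
    HasDerivAt
      (fun t : ℝ => lossCCE G σhat W μ ρ εhat εplus
        (Function.update α q (Function.update (α q) b t)))
      (epsDualCCE ρ εhat εplus α q
        - ∑ a, ACCE G q b a * sigmaDualCCE G σhat W μ α a)
      (α q b) := by
  unfold lossCCE
  simp only [upd_Ssum, upd_logits]
  have h0 : HasDerivAt (fun t : ℝ => t - α q b) 1 (α q b) := (hasDerivAt_id _).sub_const _
  have hZ : 0 < ∑ a, σhat a * Real.exp (logitsCCE G μ W α a) :=
    Finset.sum_pos (fun a _ => mul_pos (hpos a) (Real.exp_pos _)) Finset.univ_nonempty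
  have h1 : HasDerivAt (fun t : ℝ => ∑ a, σhat a *
      Real.exp (logitsCCE G μ W α a - (t - α q b) * ACCE G q b a))
      (∑ a, σhat a * (Real.exp (logitsCCE G μ W α a - (α q b - α q b) * ACCE G q b a) *
        (-(1 * ACCE G q b a)))) (α q b) :=
    HasDerivAt.fun_sum fun a _ =>
      (((h0.mul_const _).const_sub (logitsCCE G μ W α a)).exp).const_mul (σhat a)
  have h2 : HasDerivAt (fun t : ℝ => ∑ p, εplus p *
      (Ssum α p + (if p = q then 1 else 0) * (t - α q b)))
      (∑ p, εplus p * ((if p = q then 1 else 0) * 1)) (α q b) :=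
    HasDerivAt.fun_sum fun p _ => ((h0.const_mul _).const_add _).const_mul _
  have h3 : HasDerivAt (fun t : ℝ => ∑ p, (εhat p - εplus p) *
      Real.exp (-(Ssum α p + (if p = q then 1 else 0) * (t - α q b)) / ρ))
      (∑ p, (εhat p - εplus p) *
        (Real.exp (-(Ssum α p + (if p = q then 1 else 0) * (α q b - α q b)) / ρ) *
          (-((if p = q then 1 else 0) * 1) / ρ))) (α q b) :=
    HasDerivAt.fun_sum fun p _ =>
      ((((h0.const_mul _).const_add _).fun_neg.div_const ρ).exp).const_mul _
  have hne : (∑ a, σhat a *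
      Real.exp (logitsCCE G μ W α a - (α q b - α q b) * ACCE G q b a)) ≠ 0 := by
    simpa using hZ.ne'
  refine (((h1.log hne).add h2).sub (h3.const_mul ρ)).congr_deriv ?_
  have e1 : ∑ a, ACCE G q b a * sigmaDualCCE G σhat W μ α a
      = -((∑ a, σhat a * (Real.exp (logitsCCE G μ W α a) * (-ACCE G q b a)))
        / ∑ a, σhat a * Real.exp (logitsCCE G μ W α a)) := by
    unfold sigmaDualCCE
    rw [Finset.sum_div, ← Finset.sum_neg_distrib]
    exact Finset.sum_congr rfl fun a _ => by ring
  have e3 : ∑ p, (εhat p - εplus p) * (Real.exp (-Ssum α p / ρ) *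
      (-(if p = q then (1 : ℝ) else 0) / ρ))
      = (εhat q - εplus q) * (Real.exp (-Ssum α q / ρ) * (-1 / ρ)) := by
    rw [Finset.sum_eq_single q]
    · simp
    · intro p _ hp
      simp [hp]
    · simp
  have e2 : ∑ p, εplus p * (if p = q then (1 : ℝ) else 0) = εplus q := by simp
  simp only [sub_self, zero_mul, mul_zero, sub_zero, add_zero, one_mul, mul_one]
  rw [e1, e2, e3]
  unfold epsDualCCE
  field_simp
  ring

end NES
end

section
/- (CCE marginals are NE in two-player constant-sum games.) Let a two-player finite normal-form game satisfy G_1(a_1, a_2) + G_2(a_1, a_2) = c for all (a_1, a_2) and some constant c ∈ ℝ. If σ is a 0-CCE, then the product of its marginals, σ̃(a_1, a_2) = σ_1(a_1)·σ_2(a_2) where σ_1(a_1) = Σ_{a_2} σ(a_1, a_2) and σ_2(a_2) = Σ_{a_1} σ(a_1, a_2), is a 0-NE: Σ_{a} σ̃(a) A^CCE_p(a'_p, a) ≤ 0 for each player p ∈ {1,2} and all a'_p ∈ 𝒜_p. -/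
open scoped BigOperators

namespace NES

/-- In a two-player constant-sum game, the product of the marginals of any 0-CCE
is a 0-NE (stated via the CCE deviation gains for each player). -/
theorem cce_marginals_are_ne_in_constant_sum
    {A₁ A₂ : Type*} [Fintype A₁] [Fintype A₂] [Nonempty A₁] [Nonempty A₂]
    (G₁ G₂ : A₁ → A₂ → ℝ) (c : ℝ)
    (hconst : ∀ a₁ a₂, G₁ a₁ a₂ + G₂ a₁ a₂ = c)
    (σ : A₁ → A₂ → ℝ)
    (hσ0 : ∀ a₁ a₂, 0 ≤ σ a₁ a₂) (hσ1 : ∑ a₁, ∑ a₂, σ a₁ a₂ = 1)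
    (hCCE₁ : ∀ a₁' : A₁, ∑ a₁, ∑ a₂, σ a₁ a₂ * (G₁ a₁' a₂ - G₁ a₁ a₂) ≤ 0)
    (hCCE₂ : ∀ a₂' : A₂, ∑ a₁, ∑ a₂, σ a₁ a₂ * (G₂ a₁ a₂' - G₂ a₁ a₂) ≤ 0) :
    (∀ a₁' : A₁, ∑ a₁, ∑ a₂, ((∑ b₂, σ a₁ b₂) * (∑ b₁, σ b₁ a₂)) *
        (G₁ a₁' a₂ - G₁ a₁ a₂) ≤ 0) ∧
    (∀ a₂' : A₂, ∑ a₁, ∑ a₂, ((∑ b₂, σ a₁ b₂) * (∑ b₁, σ b₁ a₂)) *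
        (G₂ a₁ a₂' - G₂ a₁ a₂) ≤ 0) := by
  set x : A₁ → ℝ := fun a₁ => ∑ b₂, σ a₁ b₂ with hx
  set y : A₂ → ℝ := fun a₂ => ∑ b₁, σ b₁ a₂ with hy
  set v : ℝ := ∑ a₁, ∑ a₂, σ a₁ a₂ * G₁ a₁ a₂ with hv
  set V : ℝ := ∑ a₁, ∑ a₂, x a₁ * y a₂ * G₁ a₁ a₂ with hV
  have hG : ∀ a₁ a₂ b₁ b₂, G₂ a₁ a₂ - G₂ b₁ b₂ = G₁ b₁ b₂ - G₁ a₁ a₂ := by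
    intro a₁ a₂ b₁ b₂
    linarith [hconst a₁ a₂, hconst b₁ b₂]
  have x0 : ∀ a, 0 ≤ x a := fun a => Finset.sum_nonneg fun b _ => hσ0 a b
  have y0 : ∀ a, 0 ≤ y a := fun a => Finset.sum_nonneg fun b _ => hσ0 b a
  have x1 : ∑ a, x a = 1 := hσ1
  have y1 : ∑ a, y a = 1 := by
    rw [← hσ1, Finset.sum_comm]
  have row : ∀ a₁', ∑ a₂, y a₂ * G₁ a₁' a₂ ≤ v := by
    intro a
    have h := hCCE₁ a
    simp only [mul_sub, Finset.sum_sub_distrib] at h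
    have e : ∑ a₁, ∑ a₂, σ a₁ a₂ * G₁ a a₂ = ∑ a₂, y a₂ * G₁ a a₂ := by
      rw [Finset.sum_comm]
      simp only [hy, Finset.sum_mul]
    linarith
  have col : ∀ a₂', v ≤ ∑ a₁, x a₁ * G₁ a₁ a₂' := by
    intro a
    have h := hCCE₂ a
    simp only [hG, mul_sub, Finset.sum_sub_distrib] at h
    have e : ∑ a₁, ∑ a₂, σ a₁ a₂ * G₁ a₁ a = ∑ a₁, x a₁ * G₁ a₁ a := by
      simp only [hx, Finset.sum_mul]
    linarith
  have hVle : V ≤ v := by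
    calc V = ∑ a₁, x a₁ * ∑ a₂, y a₂ * G₁ a₁ a₂ := by
          simp only [hV, Finset.mul_sum, mul_assoc]
      _ ≤ ∑ a₁, x a₁ * v :=
          Finset.sum_le_sum fun a _ => mul_le_mul_of_nonneg_left (row a) (x0 a)
      _ = v := by rw [← Finset.sum_mul, x1, one_mul]
  have hVge : v ≤ V := by
    calc v = ∑ a₂, y a₂ * v := by rw [← Finset.sum_mul, y1, one_mul]
      _ ≤ ∑ a₂, y a₂ * ∑ a₁, x a₁ * G₁ a₁ a₂ :=
          Finset.sum_le_sum fun a _ => mul_le_mul_of_nonneg_left (col a) (y0 a)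
      _ = V := by
          rw [hV, Finset.sum_comm]
          simp only [Finset.mul_sum]
          refine Finset.sum_congr rfl fun a _ => Finset.sum_congr rfl fun b _ => ?_
          ring
  constructor
  · intro a
    change ∑ a₁, ∑ a₂, (x a₁ * y a₂) * (G₁ a a₂ - G₁ a₁ a₂) ≤ 0
    simp only [mul_sub, Finset.sum_sub_distrib]
    have e : ∑ a₁, ∑ a₂, x a₁ * y a₂ * G₁ a a₂ = ∑ a₂, y a₂ * G₁ a a₂ := by
      simp only [mul_assoc, ← Finset.mul_sum]
      rw [← Finset.sum_mul, x1, one_mul]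
    linarith [row a]
  · intro a
    change ∑ a₁, ∑ a₂, (x a₁ * y a₂) * (G₂ a₁ a - G₂ a₁ a₂) ≤ 0
    simp only [hG, mul_sub, Finset.sum_sub_distrib]
    have e : ∑ a₁, ∑ a₂, x a₁ * y a₂ * G₁ a₁ a = ∑ a₁, x a₁ * G₁ a₁ a := by
      refine Finset.sum_congr rfl fun b _ => ?_
      rw [← Finset.sum_mul, ← Finset.mul_sum, y1, mul_one]
    linarith [col a]

end NES
end

section
/- (CE maximum-welfare counterexample, Table 3(a).) Consider the symmetric two-player game on strategy sets 𝒜_1 = 𝒜_2 = {1,2,3,4} with row payoffs G_1 given by G_1(1,1) = −4, G_1(1,2) = 2, G_1(2,1) = −2, G_1(2,2) = 1, G_1(3,3) = −3, G_1(3,4) = 2, G_1(4,3) = −2, G_1(4,4) = 11/10, and G_1(i,j) = −999 for all other (i,j); column payoffs are G_2(i,j) = G_1(j,i). Then: (i) the joint distribution with σ(2,2) = 1/2 and σ(1,2) = σ(2,1) = 1/4 (and zero elsewhere) is a 0-CE with expected welfare Σ_a σ(a)(G_1(a)+G_2(a)) = 1; and (ii) every 0-CE σ' with σ'(4,4) >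 0 has expected welfare strictly less than 1. In particular, the maximum-welfare 0-CE places zero probability on the welfare-maximizing joint action (4,4). -/
open scoped BigOperators

namespace NES

/-- Row player payoffs of the CE maximum-welfare counterexample (Table 3(a));
strategies 1,2,3,4 are indexed by `0,1,2,3 : Fin 4`. -/
noncomputable def Ga : Matrix (Fin 4) (Fin 4) ℝ :=
  !![-4, 2, -999, -999;
     -2, 1, -999, -999;
     -999, -999, -3, 2;
     -999, -999, -2, 11/10]

/-- σ is a 0-CE joint distribution of the symmetric two-player game with row
payoffs `G₁` and column payoffs `G₂ i j = G₁ j i`. -/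
def IsCE2 (G₁ : Matrix (Fin 4) (Fin 4) ℝ) (σ : Fin 4 → Fin 4 → ℝ) : Prop :=
  (∀ i j, 0 ≤ σ i j) ∧ (∑ i, ∑ j, σ i j = 1) ∧
  (∀ a' a'' : Fin 4, a'' ≠ a' →
    ∑ a₂, σ a'' a₂ * (G₁ a' a₂ - G₁ a'' a₂) ≤ 0) ∧
  (∀ a' a'' : Fin 4, a'' ≠ a' →
    ∑ a₁, σ a₁ a'' * (G₁ a' a₁ - G₁ a'' a₁) ≤ 0)

/-- Expected welfare `Σ_a σ(a) (G₁(a) + G₂(a))` with `G₂ i j = G₁ j i`. -/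
noncomputable def welfare2 (G₁ : Matrix (Fin 4) (Fin 4) ℝ)
    (σ : Fin 4 → Fin 4 → ℝ) : ℝ :=
  ∑ i, ∑ j, σ i j * (G₁ i j + G₁ j i)

/-- The distribution with mass 1/2 on (2,2) and 1/4 on each of (1,2), (2,1). -/
noncomputable def σa : Fin 4 → Fin 4 → ℝ := fun i j =>
  if i = 1 ∧ j = 1 then 1/2
  else if (i = 0 ∧ j = 1) ∨ (i = 1 ∧ j = 0) then 1/4 else 0

/-- In the game of Table 3(a): the distribution supported on (1,2),(2,1),(2,2)
is a 0-CE with welfare 1, while every 0-CE placing positive mass on the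
welfare-maximizing joint action (4,4) has welfare strictly below 1. -/
theorem ce_max_welfare_counterexample :
    (IsCE2 Ga σa ∧ welfare2 Ga σa = 1) ∧
    (∀ σ' : Fin 4 → Fin 4 → ℝ, IsCE2 Ga σ' → 0 < σ' 3 3 →
      welfare2 Ga σ' < 1) := by
  refine ⟨⟨⟨?_, ?_, ?_, ?_⟩, ?_⟩, ?_⟩
  · intro i j
    unfold σa
    split_ifs <;> norm_num
  · simp [σa, Fin.sum_univ_four]
    norm_num
  · intro a b _
    fin_cases a <;> fin_cases b <;> simp [σa, Ga, Fin.sum_univ_four] <;> norm_num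
  · intro a b _
    fin_cases a <;> fin_cases b <;> simp [σa, Ga, Fin.sum_univ_four] <;> norm_num
  · simp [welfare2, σa, Ga, Fin.sum_univ_four]
    norm_num
  · rintro σ ⟨h0, h1, hr, hc⟩ hpos
    -- deviations 2 → 1 and 4 → 3 (in the paper's indexing), for both players
    have r1 := hr 0 1 (by decide)
    have r2 := hr 2 3 (by decide)
    have c1 := hc 0 1 (by decide)
    have c2 := hc 2 3 (by decide)
    simp [Ga, Fin.sum_univ_four] at r1 r2 c1 c2
    simp only [Fin.sum_univ_four] at h1
    simp [welfare2, Ga, Fin.sum_univ_four]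
    linarith [h0 0 0, h0 0 1, h0 0 2, h0 0 3, h0 1 0, h0 1 1, h0 1 2, h0 1 3,
      h0 2 0, h0 2 1, h0 2 2, h0 2 3, h0 3 0, h0 3 1, h0 3 2]

end NES
end

section
/- (CCE maximum-welfare counterexample, Table 3(b), part 1.) Consider the symmetric two-player game on strategy sets 𝒜_1 = 𝒜_2 = {1,2,3,4} with row payoffs G_1 given by the matrix with rows (2,0,0,0), (0,3,0,−10), (0,3,−10,−10), (2,7,−6,0) (i.e. G_1(i,j) is the entry in row i, column j), and column payoffs G_2(i,j) = G_1(j,i). Then the point mass δ_{(1,1)} is a 0-CCE with expected welfare 4, and every 0-CCE σ satisfies Σ_a σ(a)(G_1(a)+G_2(a)) ≤ 4; i.e. δ_{(1,1)} is a maximum-welfare 0-CCE. -/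
open scoped BigOperators

namespace NES

/-- Row player payoffs of the CCE maximum-welfare counterexample (Table 3(b));
strategies 1,2,3,4 are indexed by `0,1,2,3 : Fin 4`. -/
noncomputable def Gb : Matrix (Fin 4) (Fin 4) ℝ :=
  !![2, 0, 0, 0;
     0, 3, 0, -10;
     0, 3, -10, -10;
     2, 7, -6, 0]

/-- σ is a 0-CCE joint distribution of the symmetric two-player game with row
payoffs `G₁` and column payoffs `G₂ i j = G₁ j i`. -/
def IsCCE2 (G₁ : Matrix (Fin 4) (Fin 4) ℝ) (σ : Fin 4 → Fin 4 → ℝ) : Prop :=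
  (∀ i j, 0 ≤ σ i j) ∧ (∑ i, ∑ j, σ i j = 1) ∧
  (∀ a₁' : Fin 4, ∑ a₁, ∑ a₂, σ a₁ a₂ * (G₁ a₁' a₂ - G₁ a₁ a₂) ≤ 0) ∧
  (∀ a₂' : Fin 4, ∑ a₁, ∑ a₂, σ a₁ a₂ * (G₁ a₂' a₁ - G₁ a₂ a₁) ≤ 0)

/-- The point mass on the joint action (1,1). -/
noncomputable def δ11 : Fin 4 → Fin 4 → ℝ := fun i j =>
  if i = 0 ∧ j = 0 then 1 else 0

/-- In the game of Table 3(b): the point mass on (1,1) is a 0-CCE with welfare 4,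
and no 0-CCE achieves welfare above 4. -/
theorem cce_max_welfare_counterexample_part1 :
    IsCCE2 Gb δ11 ∧ welfare2 Gb δ11 = 4 ∧
    ∀ σ : Fin 4 → Fin 4 → ℝ, IsCCE2 Gb σ → welfare2 Gb σ ≤ 4 := by
  refine ⟨⟨?_, ?_, ?_, ?_⟩, ?_, ?_⟩
  · intro i j
    unfold δ11
    split_ifs <;> norm_num
  · simp only [δ11, Fin.sum_univ_four]
    norm_num [Fin.ext_iff]
  · intro a
    fin_cases a <;> simp [δ11, Gb, Fin.sum_univ_four]
  · intro a
    fin_cases a <;> simp [δ11, Gb, Fin.sum_univ_four]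
  · simp [welfare2, δ11, Gb, Fin.sum_univ_four]
    norm_num
  · rintro σ ⟨h0, h1, h2, h3⟩
    have e1 := h2 3
    have e2 := h3 3
    simp [Gb, Fin.sum_univ_four] at h1 e1 e2
    simp [welfare2, Gb, Fin.sum_univ_four]
    linarith [h0 0 0, h0 0 1, h0 0 2, h0 0 3, h0 1 0, h0 1 1, h0 1 2, h0 1 3,
      h0 2 0, h0 2 1, h0 2 2, h0 2 3, h0 3 0, h0 3 1, h0 3 2, h0 3 3]

end NES
end

section
/- (CEs and CCEs coincide in two-strategy games.) Let a finite normal-form game satisfy |𝒜_p| = 2 for every player p. Then for every ε ∈ ℝ^N, a joint distribution σ is an ε-CE if and only if σ is an ε-CCE. -/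
open scoped BigOperators

namespace NES

variable {N : ℕ} {A : Fin N → Type*}

/-- CE deviation gain: `G_p(a'_p, a_{-p}) − G_p(a''_p, a_{-p})` if `a_p = a''_p`, else `0`. -/
noncomputable def ACE [∀ q, DecidableEq (A q)]
    (G : ∀ _ : Fin N, (∀ q, A q) → ℝ) (p : Fin N) (a' a'' : A p)
    (a : ∀ q, A q) : ℝ :=
  if a p = a'' then G p (Function.update a p a') - G p (Function.update a p a'') else 0

/-- In a game where every player has exactly two strategies, the ε-CEs and
ε-CCEs coincide. -/
theorem ce_eq_cce_two_strategies [∀ q, Fintype (A q)] [∀ q, DecidableEq (A q)]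
    (hcard : ∀ q, Fintype.card (A q) = 2)
    (G : ∀ _ : Fin N, (∀ q, A q) → ℝ) (ε : Fin N → ℝ)
    (σ : (∀ q, A q) → ℝ) (hσ0 : ∀ a, 0 ≤ σ a) (hσ1 : ∑ a, σ a = 1) :
    (∀ (p : Fin N) (a' a'' : A p), a'' ≠ a' →
        ∑ a, σ a * ACE G p a' a'' a ≤ ε p) ↔
    (∀ (p : Fin N) (a' : A p), ∑ a, σ a * ACCE G p a' a ≤ ε p) := by
  have key : ∀ (p : Fin N) (a' a'' : A p), a'' ≠ a' → ∀ a, ACE G p a' a'' a = ACCE G p a' a := by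
    intro p a' a'' hne a
    unfold ACE ACCE
    by_cases h : a p = a''
    · subst h
      simp
    · have h2 : a p = a' := by
        by_contra h3
        have hc : ({a p, a', a''} : Finset (A p)).card = 3 :=
          Finset.card_eq_three.mpr ⟨a p, a', a'', h3, h, hne.symm, rfl⟩
        have := Finset.card_le_univ ({a p, a', a''} : Finset (A p))
        rw [hc, hcard p] at this
        omega
      subst h2
      simp [h]
  constructor
  · intro H p a'
    have : Nontrivial (A p) := Fintype.one_lt_card_iff_nontrivial.mp (by rw [hcard p]; norm_num)
    obtain ⟨a'', hne⟩ := exists_ne a'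
    have := H p a' a'' hne
    simpa only [key p a' a'' hne] using this
  · intro H p a' a'' hne
    simpa only [key p a' a'' hne] using H p a'

end NES
end
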